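/- arXiv:2312.01647 — 3 statements merged into one kernel-verified Lean document; each statement's English description precedes it below -/
import Mathlib

section
/- Let S and T be finite sets of positive integers. Then |T ◁ S| = |S| if and only if T ⪯ S. -/
/-- The `◁` operator: `tri T S = T ◁ S`.  Iterate through the elements of `S` from
largest to smallest; the current element `s` picks the largest element of `T` that is
less than `s` and has not yet been picked (if such an element exists), and the picked
elements form `T ◁ S`. -/
def tri (T S : Finset ℕ) : Finset ℕ :=
  if hS : S.Nonempty then
    if hT : (T.filter (fun t => t < S.max' hS)).Nonempty then
      insert ((T.filter (fun t => t < S.max' hS)).max' hT)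
        (tri (T.filter (fun t => t < (T.filter (fun t => t < S.max' hS)).max' hT))
          (S.erase (S.max' hS)))
    else ∅
  else ∅
termination_by S.card
decreasing_by
  exact Finset.card_erase_lt_of_mem (S.max'_mem hS)

/-- `nth S i` is the `i`-th smallest element of `S` (1-based), i.e. `S(i)`. -/
def nth (S : Finset ℕ) (i : ℕ) : ℕ :=
  (S.sort (· ≤ ·)).getD (i - 1) 0

/-- `Dom T S` means `T ⪯ S`, i.e. `S` dominates `T`:
`|T| ≥ |S|` and `T(i) < S(i)` for all `1 ≤ i ≤ |S|`. -/
def Dom (T S : Finset ℕ) : Prop :=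
  S.card ≤ T.card ∧ ∀ i, 1 ≤ i → i ≤ S.card → nth T i < nth S i

theorem list_getD_lt_iff (x : ℕ) (l : List ℕ) (hl : l.Pairwise (· ≤ ·)) (j : ℕ)
    (hj : j < l.length) : l.getD j 0 < x ↔ j < (l.filter (fun t => t < x)).length := by
  induction l generalizing j with
  | nil => simp at hj
  | cons a l ih =>
    rw [List.pairwise_cons] at hl
    by_cases ha : a < x
    · cases j with
      | zero => simp [ha]
      | succ j =>
        have := ih hl.2 j (by simpa using hj)
        simp only [List.getD_cons_succ, this]
        simp [ha]
    · have h0 : l.filter (fun t => t < x) = [] := by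
        rw [List.filter_eq_nil_iff]
        intro b hb
        have := hl.1 b hb
        simp; omega
      simp only [List.filter_cons, h0]
      cases j with
      | zero => simp [ha]
      | succ j =>
        have hj' : j < l.length := by simpa using hj
        have := hl.1 _ (List.getElem_mem hj')
        simp [ha, hj']
        omega

theorem nth_lt_iff (T : Finset ℕ) (x i : ℕ) (h1 : 1 ≤ i) (h2 : i ≤ T.card) :
    nth T i < x ↔ i ≤ (T.filter (fun t => t < x)).card := by
  unfold nth
  rw [list_getD_lt_iff x _ (T.pairwise_sort (· ≤ ·)) (i - 1) (by simp; omega)]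
  have : ((T.sort (· ≤ ·)).filter (fun t => t < x)).length
      = (T.filter (fun t => t < x)).card := by
    rw [← List.toFinset_card_of_nodup ((T.sort_nodup (· ≤ ·)).filter _)]
    congr 1
    ext a
    simp
  rw [this]
  omega

/-- Counting form of domination. -/
def CDom (T S : Finset ℕ) : Prop :=
  ∀ x, (S.filter (fun s => s < x + 1)).card ≤ (T.filter (fun t => t < x)).card

theorem dom_iff (T S : Finset ℕ) : Dom T S ↔ CDom T S := by
  constructor
  · rintro ⟨hc, h⟩ x
    rcases Nat.eq_zero_or_pos (S.filter (fun s => s < x + 1)).card with h0 | h0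
    · omega
    · have hle : (S.filter (fun s => s < x + 1)).card ≤ S.card := Finset.card_filter_le _ _
      have a := (nth_lt_iff S (x + 1) _ h0 hle).2 le_rfl
      have b := h _ h0 hle
      exact (nth_lt_iff T x _ h0 (hle.trans hc)).1 (by omega)
  · intro h
    have hc : S.card ≤ T.card := by
      have := h (S.sup id)
      rw [Finset.filter_true_of_mem] at this
      · exact this.trans (Finset.card_filter_le _ _)
      · intro s hs
        have : id s ≤ S.sup id := Finset.le_sup hs
        simp only [id] at this
        omega
    refine ⟨hc, fun i h1 h2 => ?_⟩
    rw [nth_lt_iff T _ i h1 (h2.trans hc)]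
    exact ((nth_lt_iff S _ i h1 h2).1 (Nat.lt_succ_self _)).trans (h _)

theorem tri_subset (n : ℕ) : ∀ S T : Finset ℕ, S.card = n → tri T S ⊆ T := by
  induction n with
  | zero =>
    intro S T h
    rw [Finset.card_eq_zero] at h
    subst h
    rw [tri]; simp
  | succ n ih =>
    intro S T h
    rw [tri]
    split_ifs with hS hT
    · have hm := Finset.max'_mem _ hT
      have := ih (S.erase (S.max' hS))
        (T.filter (fun t => t < (T.filter (fun t => t < S.max' hS)).max' hT))
        (by rw [Finset.card_erase_of_mem (S.max'_mem hS)]; omega)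
      refine Finset.insert_subset (Finset.mem_filter.1 hm).1
        (this.trans (Finset.filter_subset _ _))
    · simp
    · simp

theorem step (S T : Finset ℕ) (M m : ℕ) (hM : M ∈ S) (hMm : ∀ s ∈ S, s ≤ M)
    (hm : m ∈ T) (hmM : m < M) (hmm : ∀ t ∈ T, t < M → t ≤ m) :
    CDom (T.filter (fun t => t < m)) (S.erase M) ↔ CDom T S := by
  have hS : (S.erase M).card + 1 = S.card := Finset.card_erase_add_one hM
  have hT : (T.filter (fun t => t < M)).card = (T.filter (fun t => t < m)).card + 1 := by
    rw [← Finset.card_insert_of_notMem (a := m) (by simp)]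
    congr 1
    ext t
    simp only [Finset.mem_filter, Finset.mem_insert]
    constructor
    · rintro ⟨a, b⟩
      have := hmm t a b
      by_cases t = m
      · left; assumption
      · right; exact ⟨a, by omega⟩
    · rintro (rfl | ⟨a, b⟩)
      · exact ⟨hm, hmM⟩
      · exact ⟨a, by omega⟩
  have hSM : ∀ x, M ≤ x → (S.filter (fun s => s < x + 1)) = S := fun x hx =>
    Finset.filter_true_of_mem fun s hs => by have := hMm s hs; omega
  have hSx : ∀ x, x < M →
      ((S.erase M).filter (fun s => s < x + 1)) = (S.filter (fun s => s < x + 1)) := by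
    intro x hx
    ext s
    simp only [Finset.mem_filter, Finset.mem_erase]
    constructor
    · rintro ⟨⟨a, b⟩, c⟩; exact ⟨b, c⟩
    · rintro ⟨b, c⟩; exact ⟨⟨by omega, b⟩, c⟩
  constructor
  · intro h x
    rcases lt_or_ge x M with hx | hx
    · rw [← hSx x hx]
      refine (h x).trans (Finset.card_le_card ?_)
      exact Finset.filter_subset_filter _ (Finset.filter_subset _ _)
    · have h1 := h M
      rw [Finset.filter_true_of_mem (fun s hs => by
        have := hMm s (Finset.mem_of_mem_erase hs); omega)] at h1
      have h2 := Finset.card_filter_le (T.filter (fun t => t < m)) (fun t => t < M)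
      have h3 : (T.filter (fun t => t < M)).card ≤ (T.filter (fun t => t < x)).card := by
        apply Finset.card_le_card
        intro t
        simp only [Finset.mem_filter]
        rintro ⟨a, b⟩; exact ⟨a, by omega⟩
      rw [hSM x hx]
      omega
  · intro h x
    rcases lt_or_ge m x with hx | hx
    · have h1 := h M
      rw [hSM M le_rfl] at h1
      rw [Finset.filter_true_of_mem (s := T.filter (fun t => t < m)) (fun t ht => by
        have := (Finset.mem_filter.1 ht).2; omega)]
      have h2 := Finset.card_filter_le (S.erase M) (fun s => s < x + 1)
      omega
    · rw [hSx x (by omega)]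
      refine (h x).trans (Finset.card_le_card ?_)
      intro t
      simp only [Finset.mem_filter]
      rintro ⟨a, b⟩; exact ⟨⟨a, by omega⟩, b⟩

theorem tri_card_iff (n : ℕ) : ∀ S T : Finset ℕ, S.card = n →
    ((tri T S).card = S.card ↔ CDom T S) := by
  induction n with
  | zero =>
    intro S T h
    rw [Finset.card_eq_zero] at h
    subst h
    rw [tri]; simp [CDom]
  | succ n ih =>
    intro S T h
    have hS : S.Nonempty := Finset.card_pos.1 (by omega)
    rw [tri, dif_pos hS]
    have hM := S.max'_mem hS
    have hMm : ∀ s ∈ S, s ≤ S.max' hS := fun s hs => S.le_max' s hs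
    generalize S.max' hS = M at *
    split_ifs with hT
    · have hm := Finset.max'_mem _ hT
      have hmm : ∀ t ∈ T, t < M → t ≤ (T.filter (fun t => t < M)).max' hT :=
        fun t a b => Finset.le_max' _ t (Finset.mem_filter.2 ⟨a, b⟩)
      generalize (T.filter (fun t => t < M)).max' hT = m at *
      rw [Finset.mem_filter] at hm
      have hc := Finset.card_erase_add_one hM
      rw [← step S T M m hM hMm hm.1 hm.2 hmm, ← ih _ _ (by omega),
        Finset.card_insert_of_notMem]
      · omega
      · intro hmem
        have := tri_subset _ _ _ rfl hmem
        simp at this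
    · constructor
      · intro h'
        simp at h'
        omega
      · intro h'
        have h1 := h' M
        rw [Finset.not_nonempty_iff_eq_empty.1 hT] at h1
        simp only [Finset.card_empty, Nat.le_zero, Finset.card_eq_zero] at h1
        have : M ∈ S.filter (fun s => s < M + 1) := by simp [hM]
        rw [h1] at this
        simp at this

theorem stmt3 (S T : Finset ℕ) (hSpos : ∀ a ∈ S, 0 < a) (hTpos : ∀ a ∈ T, 0 < a) :
    (tri T S).card = S.card ↔ Dom T S := by
  rw [dom_iff]
  exact tri_card_iff _ S T rfl
end

section
/- Let S, S', T be finite sets of positive integers with S' ⊆ S. Then T ◁ S' ⊆ T ◁ S. -/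
theorem tri_step (T S : Finset ℕ) (s p : ℕ) (hs : s ∈ S) (hmax : ∀ x ∈ S, x ≤ s)
    (hp : p ∈ T) (hps : p < s) (hpm : ∀ t ∈ T, t < s → t ≤ p) :
    tri T S = insert p (tri (T.filter (fun t => t < p)) (S.erase s)) := by
  have hS : S.Nonempty := ⟨s, hs⟩
  have e1 : S.max' hS = s := le_antisymm (Finset.max'_le _ _ _ hmax) (Finset.le_max' _ _ hs)
  subst e1
  have hmem : p ∈ T.filter (fun t => t < S.max' hS) := by simp only [Finset.mem_filter]; exact ⟨hp, hps⟩
  have hT : (T.filter (fun t => t < S.max' hS)).Nonempty := ⟨p, hmem⟩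
  have e2 : (T.filter (fun t => t < S.max' hS)).max' hT = p := by
    apply le_antisymm
    · apply Finset.max'_le
      intro y hy
      rw [Finset.mem_filter] at hy
      exact hpm y hy.1 hy.2
    · exact Finset.le_max' _ _ hmem
  rw [tri, dif_pos hS, dif_pos hT, e2]

theorem tri_none (T S : Finset ℕ) (h : ∀ s ∈ S, ∀ t ∈ T, ¬ t < s) : tri T S = ∅ := by
  rw [tri]
  split_ifs with hS hT
  · obtain ⟨t, ht⟩ := hT
    rw [Finset.mem_filter] at ht
    exact absurd ht.2 (h _ (S.max'_mem hS) t ht.1)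
  · rfl
  · rfl

theorem exists_pick (T : Finset ℕ) (s : ℕ) (h : ∃ t ∈ T, t < s) :
    ∃ p ∈ T, p < s ∧ ∀ t ∈ T, t < s → t ≤ p := by
  obtain ⟨t, ht, hts⟩ := h
  have hne : (T.filter (fun t => t < s)).Nonempty := ⟨t, by simp [ht, hts]⟩
  have := Finset.max'_mem _ hne
  rw [Finset.mem_filter] at this
  exact ⟨_, this.1, this.2, fun u hu hus => Finset.le_max' _ _ (by simp [hu, hus])⟩

theorem tri_mono_aux (n : ℕ) : ∀ S S' T : Finset ℕ, S.card ≤ n → S' ⊆ S →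
    tri T S' ⊆ tri T S := by
  induction n with
  | zero =>
    intro S S' T hc hsub
    have : S = ∅ := by simpa using hc
    subst this
    rw [Finset.subset_empty.1 hsub]
  | succ n ih =>
    intro S S' T hc hsub
    rcases S.eq_empty_or_nonempty with rfl | hS
    · rw [Finset.subset_empty.1 hsub]
    obtain ⟨M, hM, hMmax⟩ : ∃ M ∈ S, ∀ x ∈ S, x ≤ M :=
      ⟨S.max' hS, S.max'_mem hS, fun x hx => S.le_max' x hx⟩
    have hcard : (S.erase M).card ≤ n := by
      rw [Finset.card_erase_of_mem hM]; omega
    by_cases hex : ∃ t ∈ T, t < M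
    swap
    · push Not at hex
      rw [tri_none T S']
      · simp
      · intro s hs t ht hlt
        have := hMmax s (hsub hs)
        have := hex t ht
        omega
    obtain ⟨m, hm, hmM, hmm⟩ := exists_pick T M hex
    rw [tri_step T S M m hM hMmax hm hmM hmm]
    by_cases hMS : M ∈ S'
    · rw [tri_step T S' M m hMS (fun x hx => hMmax x (hsub hx)) hm hmM hmm]
      exact Finset.insert_subset_insert _ (ih _ _ _ hcard (Finset.erase_subset_erase _ hsub))
    have hsub' : S' ⊆ S.erase M := fun x hx =>
      Finset.mem_erase.2 ⟨fun h => hMS (h ▸ hx), hsub hx⟩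
    refine (ih _ _ T hcard hsub').trans ?_
    have hlt : ∀ x ∈ S.erase M, x < M := fun x hx =>
      lt_of_le_of_ne (hMmax x (Finset.mem_of_mem_erase hx)) (Finset.ne_of_mem_erase hx)
    generalize S.erase M = S0 at hcard hlt
    rcases S0.eq_empty_or_nonempty with rfl | hS0
    · rw [tri_none T ∅ (by simp)]; simp
    obtain ⟨s, hs, hsmax⟩ : ∃ M ∈ S0, ∀ x ∈ S0, x ≤ M :=
      ⟨S0.max' hS0, S0.max'_mem hS0, fun x hx => S0.le_max' x hx⟩
    by_cases hex2 : ∃ t ∈ T, t < s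
    swap
    · push Not at hex2
      rw [tri_none T S0]
      · simp
      · intro x hx t ht hlt
        have := hsmax x hx
        have := hex2 t ht
        omega
    obtain ⟨p, hp, hps, hpm⟩ := exists_pick T s hex2
    have hsM := hlt s hs
    have hpm' : p ≤ m := hmm p hp (by omega)
    rw [tri_step T S0 s p hs hsmax hp hps hpm]
    rcases hpm'.eq_or_lt with rfl | hlt'
    · exact Finset.insert_subset_insert _ (ih _ _ _ hcard (Finset.erase_subset _ _))
    · rw [tri_step (T.filter (fun t => t < m)) S0 s p hs hsmax (by simp [hp, hlt']) hps
        (fun t ht => hpm t (Finset.mem_filter.1 ht).1)]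
      have : (T.filter (fun t => t < m)).filter (fun t => t < p) = T.filter (fun t => t < p) := by
        ext t
        simp only [Finset.mem_filter]
        constructor
        · rintro ⟨⟨a, _⟩, c⟩; exact ⟨a, c⟩
        · rintro ⟨a, c⟩; exact ⟨⟨a, by omega⟩, c⟩
      rw [this]
      exact Finset.subset_insert _ _

theorem stmt10 (S S' T : Finset ℕ) (hSpos : ∀ a ∈ S, 0 < a) (hTpos : ∀ a ∈ T, 0 < a)
    (hsub : S' ⊆ S) :
    tri T S' ⊆ tri T S := by
  exact tri_mono_aux S.card S S' T le_rfl hsub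
end

section
/- Let n be a positive integer and let A and A' be finite sets of positive integers with m := |A| satisfying 1 ≤ m ≤ n and |A'| ≥ m. Then cap_n(A)(i) ≥ A'(i) for all 1 ≤ i ≤ m if and only if A(i) ≥ A'(i) for all 1 ≤ i ≤ m and A'(m) ≤ n. (This is the column-by-column form of the assertion that for keys T, T', one has cap_n(T) ≥ T' entrywise if and only if T ≥ T' entrywise and max(T') ≤ n.) -/
/-- `capn n A = cap_n(A)`: for `i ∈ [n]`, `i ∈ cap_n(A)` if and only if
`i ∈ A` or `|{a ∈ A : a > i}| > n - i`. -/
def capn (n : ℕ) (A : Finset ℕ) : Finset ℕ :=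
  (Finset.Icc 1 n).filter (fun i => i ∈ A ∨ n - i < (A.filter (fun a => i < a)).card)

lemma nth_eq_nat_nth (S : Finset ℕ) (i : ℕ) : nth S i = Nat.nth (· ∈ S) (i - 1) := by
  have hf : (Set.ofPred (· ∈ S)).Finite := S.finite_toSet
  rw [Nat.nth_eq_getD_sort hf]
  have : hf.toFinset = S := by ext a; rw [Set.Finite.mem_toFinset]; exact Iff.rfl
  rw [this]; rfl

lemma le_nth_iff (S : Finset ℕ) (i x : ℕ) (h1 : 1 ≤ i) (h2 : i ≤ S.card) :
    x ≤ nth S i ↔ Nat.count (· ∈ S) x < i := by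
  have hc : ∀ hf : (Set.ofPred (· ∈ S)).Finite, i - 1 < hf.toFinset.card := by
    intro hf
    have : hf.toFinset = S := by ext a; rw [Set.Finite.mem_toFinset]; exact Iff.rfl
    rw [this]; omega
  have e := Nat.count_nth (p := (· ∈ S)) hc
  have hm := Nat.nth_mem (p := (· ∈ S)) (i - 1) hc
  rw [nth_eq_nat_nth]
  constructor
  · intro h
    have := Nat.count_monotone (· ∈ S) h
    omega
  · intro h
    by_contra! h'
    have := Nat.count_strict_mono (p := (· ∈ S)) hm h'
    omega

lemma count_add_card (S : Finset ℕ) (x : ℕ) :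
    Nat.count (· ∈ S) (x + 1) + (S.filter (fun a => x < a)).card = S.card := by
  have h := Finset.card_filter_add_card_filter_not (s := S) (fun a => x < a)
  have e : Nat.count (· ∈ S) (x + 1) = (S.filter (fun a => ¬ x < a)).card := by
    rw [Nat.count_eq_card_filter_range]
    congr 1; ext a; simp; constructor <;> rintro ⟨h1, h2⟩ <;> constructor <;> first | assumption | omega
  omega

lemma count_capn (n : ℕ) (A : Finset ℕ) (hApos : ∀ a ∈ A, 0 < a) (hmn : A.card ≤ n)
    (x : ℕ) (hx : x ≤ n + 1) :
    Nat.count (· ∈ capn n A) x = max (Nat.count (· ∈ A) x) (A.card + x - (n + 1)) := by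
  induction x with
  | zero => simp; omega
  | succ x ih =>
    have ih := ih (by omega)
    have hk := count_add_card A x
    have hmem : x ∈ capn n A ↔ (1 ≤ x ∧ x ≤ n) ∧
        (x ∈ A ∨ n - x < (A.filter (fun a => x < a)).card) := by
      simp [capn]
    have h0 := hApos x
    rw [Nat.count_succ] at hk
    rw [Nat.count_succ, Nat.count_succ, ih]
    by_cases hA : x ∈ A
    · have := h0 hA
      have hC : x ∈ capn n A := hmem.2 ⟨by omega, Or.inl hA⟩
      simp only [hA, hC, if_true] at *
      omega
    · by_cases hC : x ∈ capn n A
      · have := hmem.1 hC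
        simp only [hA, hC, if_true, if_false, false_or] at *
        omega
      · have : ¬ ((1 ≤ x ∧ x ≤ n) ∧ n - x < (A.filter (fun a => x < a)).card) := by
          rintro ⟨h, h'⟩; exact hC (hmem.2 ⟨h, Or.inr h'⟩)
        simp only [hA, hC, if_false] at *
        omega

lemma le_nth_capn (n : ℕ) (A : Finset ℕ) (hApos : ∀ a ∈ A, 0 < a) (hmn : A.card ≤ n)
    (i x : ℕ) (h1 : 1 ≤ i) (h2 : i ≤ A.card) :
    x ≤ nth (capn n A) i ↔ x ≤ nth A i ∧ x + A.card ≤ n + i := by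
  have hA := Nat.count_monotone (· ∈ A) (Nat.zero_le (n+1))
  have hA2 := count_add_card A n
  have hC2 := count_add_card (capn n A) n
  have hn := count_capn n A hApos hmn (n + 1) le_rfl
  rw [le_nth_iff A i x h1 h2, le_nth_iff _ i x h1 (by omega)]
  by_cases hx : x ≤ n + 1
  · rw [count_capn n A hApos hmn x hx]; omega
  · have := Nat.count_monotone (· ∈ capn n A) (show n + 1 ≤ x by omega)
    omega

lemma nth_add_le (S : Finset ℕ) (i d : ℕ) (h1 : 1 ≤ i) (h2 : i + d ≤ S.card) :
    nth S i + d ≤ nth S (i + d) := by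
  have h := (le_nth_iff S i _ h1 (by omega)).1 le_rfl
  rw [le_nth_iff S (i + d) _ (by omega) h2, Nat.count_add]
  have := Nat.count_le (p := fun k => nth S i + k ∈ S) (n := d)
  omega

theorem stmt17 (n : ℕ) (hn : 0 < n) (A A' : Finset ℕ)
    (hApos : ∀ a ∈ A, 0 < a) (hA'pos : ∀ a ∈ A', 0 < a)
    (hm1 : 1 ≤ A.card) (hmn : A.card ≤ n) (hA' : A.card ≤ A'.card) :
    (∀ i, 1 ≤ i → i ≤ A.card → nth A' i ≤ nth (capn n A) i) ↔
      ((∀ i, 1 ≤ i → i ≤ A.card → nth A' i ≤ nth A i) ∧ nth A' A.card ≤ n) := by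
  constructor
  · intro h
    refine ⟨fun i h1 h2 => ((le_nth_capn n A hApos hmn i _ h1 h2).1 (h i h1 h2)).1, ?_⟩
    have := ((le_nth_capn n A hApos hmn _ _ hm1 le_rfl).1 (h _ hm1 le_rfl)).2
    omega
  · rintro ⟨h, h'⟩ i h1 h2
    refine (le_nth_capn n A hApos hmn i _ h1 h2).2 ⟨h i h1 h2, ?_⟩
    have := nth_add_le A' i (A.card - i) h1 (by omega)
    rw [show i + (A.card - i) = A.card by omega] at this
    omega
end
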